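/- Let S² = {x ∈ ℝ³ : x₁² + x₂² + x₃² = 1}, let H₊ = {x ∈ S² : x₃ ≥ 0} and H₋ = {x ∈ S² : x₃ ≤ 0}. Then there do not exist continuous functions f₊ : H₊ → ℂ \ {0} and f₋ : H₋ → ℂ \ {0} such that f₊(x) = (x₁ + i·x₂)·f₋(x) for all x ∈ S² with x₃ = 0. -/

import Mathlib

/-- A nonvanishing continuous function on a simply connected, locally path connected space has a
continuous logarithm. -/
theorem Continuous.exists_continuous_exp_eq {X : Type*} [TopologicalSpace X]
    [SimplyConnectedSpace X] [LocallyPathConnectedSpace X] {g : X → ℂ} (hg : Continuous g)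
    (hg₀ : ∀ x, g x ≠ 0) : ∃ L : X → ℂ, Continuous L ∧ ∀ x, Complex.exp (L x) = g x := by
  obtain ⟨x₀⟩ : Nonempty X := PathConnectedSpace.nonempty
  obtain ⟨L, ⟨-, hL⟩, -⟩ := Complex.isCoveringMapOn_exp.existsUnique_continuousMap_lifts
    (⟨g, hg⟩ : C(X, ℂ)) (a₀ := x₀) (Complex.exp_log (hg₀ x₀)) hg₀
  exact ⟨L, L.continuous, congrFun hL⟩

/-- There is no continuous logarithm on the unit circle. -/
theorem Complex.not_exists_continuous_log_unit_circle :
    ¬ ∃ L : ℂ → ℂ, Continuous L ∧ ∀ z, ‖z‖ = 1 → Complex.exp (L z) = z := by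
  rintro ⟨L, hL, hexp⟩
  have hφ : Continuous fun θ : ℝ ↦ L (exp (θ * I)) - θ * I := by fun_prop
  have hφ_exp (θ : ℝ) : exp (L (exp (θ * I)) - θ * I) = 1 := by
    rw [exp_sub, hexp _ (norm_exp_ofReal_mul_I θ), div_self (exp_ne_zero _)]
  have h := isCoveringMap_exp.const_of_comp hφ
    (fun θ θ' ↦ Subtype.ext ((hφ_exp θ).trans (hφ_exp θ').symm)) 0 (2 * Real.pi)
  rw [eq_comm] at h
  simp [exp_two_pi_mul_I, Real.pi_ne_zero] at h

/-- Stereographic projection folded onto the hemisphere on which `s * x 2 ≥ 0`, for `s = ± 1`. -/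
noncomputable def toHemisphere (s : ℝ) (z : ℂ) : Fin 3 → ℝ :=
  ![2 * z.re / (1 + ‖z‖ ^ 2), 2 * z.im / (1 + ‖z‖ ^ 2), s * (|1 - ‖z‖ ^ 2| / (1 + ‖z‖ ^ 2))]

theorem continuous_toHemisphere (s : ℝ) : Continuous (toHemisphere s) := by
  have h (z : ℂ) : 1 + ‖z‖ ^ 2 ≠ 0 := by positivity
  refine continuous_pi fun i ↦ ?_
  fin_cases i <;> simp only [toHemisphere] <;> simp <;> fun_prop (disch := exact h _)

theorem toHemisphere_mem_sphere {s : ℝ} (hs : s ^ 2 = 1) (z : ℂ) :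
    toHemisphere s z 0 ^ 2 + toHemisphere s z 1 ^ 2 + toHemisphere s z 2 ^ 2 = 1 := by
  have h : 1 + ‖z‖ ^ 2 ≠ 0 := by positivity
  have hz : ‖z‖ ^ 2 = z.re ^ 2 + z.im ^ 2 := by rw [Complex.sq_norm, Complex.normSq_apply]; ring
  simp only [toHemisphere, Matrix.cons_val, mul_pow, div_pow, sq_abs, hs]
  field_simp
  rw [hz]
  ring

theorem toHemisphere_of_norm_eq_one (s : ℝ) {z : ℂ} (hz : ‖z‖ = 1) :
    toHemisphere s z = ![z.re, z.im, 0] := by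
  ext i
  fin_cases i <;> simp [toHemisphere, hz] <;> ring


/-- There are no continuous nonvanishing functions `f₊` on the closed upper hemisphere and
`f₋` on the closed lower hemisphere of `S² ⊆ ℝ³` with `f₊(x) = (x₁ + i·x₂)·f₋(x)` on the
equator. -/
theorem no_continuous_splitting_on_hemispheres :
    ¬ ∃ (fp fm : (Fin 3 → ℝ) → ℂ),
      ContinuousOn fp {x : Fin 3 → ℝ | x 0 ^ 2 + x 1 ^ 2 + x 2 ^ 2 = 1 ∧ 0 ≤ x 2} ∧
      ContinuousOn fm {x : Fin 3 → ℝ | x 0 ^ 2 + x 1 ^ 2 + x 2 ^ 2 = 1 ∧ x 2 ≤ 0} ∧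
      (∀ x : Fin 3 → ℝ, x 0 ^ 2 + x 1 ^ 2 + x 2 ^ 2 = 1 → 0 ≤ x 2 → fp x ≠ 0) ∧
      (∀ x : Fin 3 → ℝ, x 0 ^ 2 + x 1 ^ 2 + x 2 ^ 2 = 1 → x 2 ≤ 0 → fm x ≠ 0) ∧
      (∀ x : Fin 3 → ℝ, x 0 ^ 2 + x 1 ^ 2 + x 2 ^ 2 = 1 → x 2 = 0 →
        fp x = ((x 0 : ℂ) + Complex.I * (x 1 : ℂ)) * fm x) := by
  rintro ⟨fp, fm, hfp, hfm, hfp₀, hfm₀, h⟩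
  have hp := toHemisphere_mem_sphere (one_pow 2 : (1 : ℝ) ^ 2 = 1)
  have hm := toHemisphere_mem_sphere (by norm_num : (-1 : ℝ) ^ 2 = 1)
  have hp' (z : ℂ) : 0 ≤ toHemisphere 1 z 2 := by
    simp only [toHemisphere, Matrix.cons_val]; positivity
  have hm' (z : ℂ) : toHemisphere (-1) z 2 ≤ 0 := by
    simp only [toHemisphere, Matrix.cons_val, neg_one_mul, neg_nonpos]; positivity
  obtain ⟨Lp, hLp, hLp_exp⟩ := (hfp.comp_continuous (continuous_toHemisphere 1)
    fun z ↦ ⟨hp z, hp' z⟩).exists_continuous_exp_eq fun z ↦ hfp₀ _ (hp z) (hp' z)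
  obtain ⟨Lm, hLm, hLm_exp⟩ := (hfm.comp_continuous (continuous_toHemisphere (-1))
    fun z ↦ ⟨hm z, hm' z⟩).exists_continuous_exp_eq fun z ↦ hfm₀ _ (hm z) (hm' z)
  refine Complex.not_exists_continuous_log_unit_circle ⟨fun z ↦ Lp z - Lm z, hLp.sub hLm,
    fun z hz ↦ ?_⟩
  have h₁ := hp z
  have h₂ := hfm₀ _ (hm z) (hm' z)
  rw [toHemisphere_of_norm_eq_one _ hz] at h₁ h₂
  rw [Complex.exp_sub, hLp_exp, hLm_exp, Function.comp_apply, Function.comp_apply,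
    toHemisphere_of_norm_eq_one _ hz, toHemisphere_of_norm_eq_one _ hz, h _ h₁ rfl, mul_div_cancel_right₀ _ h₂]
  simpa [mul_comm] using Complex.re_add_im z
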